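/- arXiv:0906.5106 — 7 statements merged into one kernel-verified Lean document; each statement's English description precedes it below -/
import Mathlib

section
/- Every subset S of ℤ^n has only finitely many ⊑-minimal elements. In particular, for every integer m×n matrix A, the Graver basis 𝒢(A) is a finite set. -/
/-- The partial order `⊑` on `ℤ^n`: `x ⊑ y` iff `x` lies in the same closed orthant
as `y` and is componentwise bounded by `y` in absolute value. -/
def Conforms {β : Type*} (x y : β → ℤ) : Prop :=
  ∀ i, 0 ≤ x i * y i ∧ |x i| ≤ |y i|

/-- The Graver basis of an integer matrix `A`: the `⊑`-minimal elements of
`{x ∈ ℤ^n : Ax = 0, x ≠ 0}`. -/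
def GraverBasis {α β : Type*} [Fintype β] (A : Matrix α β ℤ) : Set (β → ℤ) :=
  {x | A.mulVec x = 0 ∧ x ≠ 0 ∧
    ∀ y : β → ℤ, A.mulVec y = 0 → y ≠ 0 → Conforms y x → y = x}

/-- The positive and negative parts of the coordinates of an integer vector. -/
def posNegParts {β : Type*} (x : β → ℤ) : β → ℕ × ℕ :=
  fun i => ((x i).toNat, (-x i).toNat)

theorem posNegParts_injective {β : Type*} :
    Function.Injective (posNegParts : (β → ℤ) → β → ℕ × ℕ) := by
  intro x y h
  funext i
  have hi := congrFun h i
  simp only [posNegParts, Prod.mk.injEq] at hi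
  omega

theorem conforms_of_posNegParts_le {β : Type*} {x y : β → ℤ}
    (h : posNegParts x ≤ posNegParts y) : Conforms x y := by
  intro i
  obtain ⟨hpos, hneg⟩ : (x i).toNat ≤ (y i).toNat ∧ (-x i).toNat ≤ (-y i).toNat := h i
  refine ⟨?_, by simp only [Int.abs_eq_natAbs]; omega⟩
  rcases lt_trichotomy (x i) 0 with hx | hx | hx
  · exact mul_nonneg_of_nonpos_of_nonpos hx.le (by omega)
  · simp [hx]
  · exact mul_nonneg hx.le (by omega)

theorem finite_conforms_minimal {β : Type*} [Finite β] (S : Set (β → ℤ)) :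
    {x ∈ S | ∀ y ∈ S, Conforms y x → y = x}.Finite := by
  refine Set.Finite.of_finite_image ?_ (posNegParts_injective.injOn (f := posNegParts))
  apply WellQuasiOrderedLE.finite_of_isAntichain
  rintro _ ⟨x, hx, rfl⟩ _ ⟨y, hy, rfl⟩ hne hle
  exact hne (congrArg posNegParts (hy.2 x hx.1 (conforms_of_posNegParts_le hle)))

/-- Every subset `S ⊆ ℤ^n` has only finitely many `⊑`-minimal elements; in particular,
for every integer `m × n` matrix `A`, the Graver basis `𝒢(A)` is a finite set. -/
theorem finitely_many_sqsubseteq_minimal_elements (n : ℕ) :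
    (∀ S : Set (Fin n → ℤ),
      {x ∈ S | ∀ y ∈ S, Conforms y x → y = x}.Finite) ∧
    (∀ (m : ℕ) (A : Matrix (Fin m) (Fin n) ℤ), (GraverBasis A).Finite) := by
  refine ⟨finite_conforms_minimal, fun m A => ?_⟩
  refine (finite_conforms_minimal {x | A.mulVec x = 0 ∧ x ≠ 0}).subset ?_
  rintro x ⟨hA, hx, hmin⟩
  exact ⟨⟨hA, hx⟩, fun y hy => hmin y hy.1 hy.2⟩
end

section
/- Let A be an (r,s)×t integer bimatrix, W a (p,q)×t integer bimatrix, and let D be the (r+p, s+q)×(t+p+q) bimatrix with blocks D₁ = [A₁ 0 0; W₁ I_p 0] and D₂ = [A₂ 0 0; W₂ 0 I_q]. Then for every positive integer n there exist a permutation of the rows and a permutation of the columns transforming the n-fold product D^{(n)} into the (r+ns+p+nq)×(nt+np+nq) matrix C whose blocks are: top rows [A^{(n)}, 0, 0]; next p rows [(W₁ W₁ ⋯ W₁), (I_p I_p ⋯ I_p), 0]; and bottom nq rows [diag(W₂,…,W₂), 0, I_{nq}]. Equivalently, there exist permutation matrices P and Q with P·D^{(n)}·Q = C. -/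
/-- The `n`-fold product of an `(r,s) × t` bimatrix with blocks `A₁` (rows `α`) and
`A₂` (rows `β`): first the rows `(A₁ A₁ ⋯ A₁)`, then the block-diagonal part with
`n` copies of `A₂`. -/
def nFold {α β γ : Type*} (n : ℕ) (A₁ : Matrix α γ ℤ) (A₂ : Matrix β γ ℤ) :
    Matrix (α ⊕ Fin n × β) (Fin n × γ) ℤ :=
  Matrix.of fun i kj =>
    match i with
    | Sum.inl a => A₁ a kj.2
    | Sum.inr kb => if kb.1 = kj.1 then A₂ kb.2 kj.2 else 0

section
variable {r s t p q : ℕ}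

/-- The block `D₁ = [A₁ 0 0; W₁ I_p 0]`. -/
def Dtop (A₁ : Matrix (Fin r) (Fin t) ℤ) (W₁ : Matrix (Fin p) (Fin t) ℤ) (q : ℕ) :
    Matrix (Fin r ⊕ Fin p) (Fin t ⊕ (Fin p ⊕ Fin q)) ℤ :=
  Matrix.of fun i j =>
    match i, j with
    | Sum.inl a, Sum.inl e => A₁ a e
    | Sum.inl _, Sum.inr _ => 0
    | Sum.inr a, Sum.inl e => W₁ a e
    | Sum.inr a, Sum.inr (Sum.inl b) => if a = b then 1 else 0
    | Sum.inr _, Sum.inr (Sum.inr _) => 0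

/-- The block `D₂ = [A₂ 0 0; W₂ 0 I_q]`. -/
def Dbot (A₂ : Matrix (Fin s) (Fin t) ℤ) (W₂ : Matrix (Fin q) (Fin t) ℤ) (p : ℕ) :
    Matrix (Fin s ⊕ Fin q) (Fin t ⊕ (Fin p ⊕ Fin q)) ℤ :=
  Matrix.of fun i j =>
    match i, j with
    | Sum.inl a, Sum.inl e => A₂ a e
    | Sum.inl _, Sum.inr _ => 0
    | Sum.inr a, Sum.inl e => W₂ a e
    | Sum.inr _, Sum.inr (Sum.inl _) => 0
    | Sum.inr a, Sum.inr (Sum.inr b) => if a = b then 1 else 0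

/-- The matrix `C` with blocks: top rows `[A⁽ⁿ⁾ 0 0]`; next `p` rows
`[(W₁ W₁ ⋯ W₁) (I_p I_p ⋯ I_p) 0]`; bottom `nq` rows `[diag(W₂,…,W₂) 0 I_{nq}]`. -/
def Cmat (n : ℕ) (A₁ : Matrix (Fin r) (Fin t) ℤ) (A₂ : Matrix (Fin s) (Fin t) ℤ)
    (W₁ : Matrix (Fin p) (Fin t) ℤ) (W₂ : Matrix (Fin q) (Fin t) ℤ) :
    Matrix ((Fin r ⊕ Fin n × Fin s) ⊕ (Fin p ⊕ Fin n × Fin q))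
      ((Fin n × Fin t) ⊕ ((Fin n × Fin p) ⊕ (Fin n × Fin q))) ℤ :=
  Matrix.of fun i j =>
    match i, j with
    | Sum.inl a, Sum.inl ke => nFold n A₁ A₂ a ke
    | Sum.inl _, Sum.inr _ => 0
    | Sum.inr (Sum.inl a), Sum.inl ke => W₁ a ke.2
    | Sum.inr (Sum.inl a), Sum.inr (Sum.inl kb) => if a = kb.2 then 1 else 0
    | Sum.inr (Sum.inl _), Sum.inr (Sum.inr _) => 0
    | Sum.inr (Sum.inr ka), Sum.inl ke => if ka.1 = ke.1 then W₂ ka.2 ke.2 else 0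
    | Sum.inr (Sum.inr _), Sum.inr (Sum.inl _) => 0
    | Sum.inr (Sum.inr ka), Sum.inr (Sum.inr kb) => if ka = kb then 1 else 0

end

/-- For every positive `n` there are a permutation of the rows and a permutation of the
columns transforming the `n`-fold product `D⁽ⁿ⁾` of the bimatrix `D` with blocks
`D₁ = [A₁ 0 0; W₁ I_p 0]` and `D₂ = [A₂ 0 0; W₂ 0 I_q]` into the matrix `C` with blocks:
top rows `[A⁽ⁿ⁾ 0 0]`; next `p` rows `[(W₁ ⋯ W₁) (I_p ⋯ I_p) 0]`; bottom `nq` rows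
`[diag(W₂,…,W₂) 0 I_{nq}]`. -/
theorem nfold_row_col_permute (r s t p q n : ℕ) (hn : 0 < n)
    (A₁ : Matrix (Fin r) (Fin t) ℤ) (A₂ : Matrix (Fin s) (Fin t) ℤ)
    (W₁ : Matrix (Fin p) (Fin t) ℤ) (W₂ : Matrix (Fin q) (Fin t) ℤ) :
    ∃ (eR : ((Fin r ⊕ Fin p) ⊕ Fin n × (Fin s ⊕ Fin q)) ≃
        ((Fin r ⊕ Fin n × Fin s) ⊕ (Fin p ⊕ Fin n × Fin q)))
      (eC : (Fin n × (Fin t ⊕ (Fin p ⊕ Fin q))) ≃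
        ((Fin n × Fin t) ⊕ ((Fin n × Fin p) ⊕ (Fin n × Fin q)))),
      Matrix.reindex eR eC (nFold n (Dtop A₁ W₁ q) (Dbot A₂ W₂ p)) = Cmat n A₁ A₂ W₁ W₂ := by
  refine ⟨((Equiv.refl _).sumCongr (Equiv.prodSumDistrib _ _ _)).trans
      (Equiv.sumSumSumComm _ _ _ _),
    (Equiv.prodSumDistrib _ _ _).trans
      ((Equiv.refl _).sumCongr (Equiv.prodSumDistrib _ _ _)), ?_⟩
  ext i j
  rcases i with (a | ⟨k, a⟩) | (a | ⟨k, a⟩) <;>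
    rcases j with ⟨l, b⟩ | ⟨l, b⟩ | ⟨l, b⟩ <;>
    simp [nFold, Dtop, Dbot, Cmat, Prod.ext_iff, ite_and]
end

section
/- Let A be an (r,s)×t integer bimatrix, W a (p,q)×t integer bimatrix, and n a positive integer. Let B be the (r+ns+p+nq)×(nt+p+nq) matrix B = [A^{(n)}, 0; W^{(n)}, I_{p+nq}], and let C be the (r+ns+p+nq)×(nt+np+nq) matrix with blocks: top rows [A^{(n)}, 0, 0]; next p rows [(W₁ W₁ ⋯ W₁), (I_p I_p ⋯ I_p), 0]; bottom nq rows [diag(W₂,…,W₂), 0, I_{nq}]. Index vectors of length nt+np+nq as (x, y¹, …, yⁿ, z) with x ∈ ℤ^{nt}, each y^k ∈ ℤ^p, and z ∈ ℤ^{nq}. Then 𝒢(B) = {(x, y¹, z) : (x, y¹, 0, …, 0, z) ∈ 𝒢(C)}; that is, the Graver basis of B consists exactly of the restrictions of those elements of 𝒢(C) whose blocks y², …, yⁿ all vanish. -/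
section
variable {r s t p q : ℕ}

/-- The matrix `B = [A⁽ⁿ⁾ 0; W⁽ⁿ⁾ I_{p+nq}]`. -/
def Bmat (n : ℕ) (A₁ : Matrix (Fin r) (Fin t) ℤ) (A₂ : Matrix (Fin s) (Fin t) ℤ)
    (W₁ : Matrix (Fin p) (Fin t) ℤ) (W₂ : Matrix (Fin q) (Fin t) ℤ) :
    Matrix ((Fin r ⊕ Fin n × Fin s) ⊕ (Fin p ⊕ Fin n × Fin q))
      ((Fin n × Fin t) ⊕ (Fin p ⊕ Fin n × Fin q)) ℤ :=
  Matrix.fromBlocks (nFold n A₁ A₂) 0 (nFold n W₁ W₂) 1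

/-- Extend a vector `(x, y¹, z)` indexed by the columns of `B` to the vector
`(x, y¹, 0, …, 0, z)` indexed by the columns of `C`, placing `y¹` in the first of the
`n` copies of the `y`-blocks and `0` in all the others. -/
def extendVec (n : ℕ) (hn : 0 < n)
    (v : (Fin n × Fin t) ⊕ (Fin p ⊕ Fin n × Fin q) → ℤ) :
    (Fin n × Fin t) ⊕ ((Fin n × Fin p) ⊕ (Fin n × Fin q)) → ℤ :=
  Sum.elim (fun ke => v (Sum.inl ke))
    (Sum.elim
      (fun kb : Fin n × Fin p =>
        if kb.1 = (⟨0, hn⟩ : Fin n) then v (Sum.inr (Sum.inl kb.2)) else 0)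
      (fun kb : Fin n × Fin q => v (Sum.inr (Sum.inr kb))))

end

theorem extendVec_injective {t p q n : ℕ} (hn : 0 < n) :
    Function.Injective (extendVec (t := t) (p := p) (q := q) n hn) := by
  intro u v h
  ext (i | i | i)
  · exact congrFun h (Sum.inl i)
  · simpa [extendVec] using congrFun h (Sum.inr (Sum.inl (⟨0, hn⟩, i)))
  · exact congrFun h (Sum.inr (Sum.inr i))

theorem extendVec_zero {t p q n : ℕ} (hn : 0 < n) :
    extendVec (t := t) (p := p) (q := q) n hn 0 = 0 := by
  ext (i | i | i) <;> simp [extendVec]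

theorem extendVec_ne_zero_iff {t p q n : ℕ} (hn : 0 < n)
    (v : (Fin n × Fin t) ⊕ (Fin p ⊕ Fin n × Fin q) → ℤ) :
    extendVec n hn v ≠ 0 ↔ v ≠ 0 := by
  rw [← extendVec_zero hn, (extendVec_injective hn).ne_iff]

theorem conforms_extendVec_iff {t p q n : ℕ} (hn : 0 < n)
    (u v : (Fin n × Fin t) ⊕ (Fin p ⊕ Fin n × Fin q) → ℤ) :
    Conforms (extendVec n hn u) (extendVec n hn v) ↔ Conforms u v := by
  constructor
  · rintro h (i | i | i)
    · exact h (Sum.inl i)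
    · simpa [extendVec] using h (Sum.inr (Sum.inl (⟨0, hn⟩, i)))
    · exact h (Sum.inr (Sum.inr i))
  · rintro h (i | i | i)
    · exact h (Sum.inl i)
    · by_cases hi : i.1 = ⟨0, hn⟩
      · simpa [extendVec, hi] using h (Sum.inr (Sum.inl i.2))
      · simp [extendVec, hi]
    · exact h (Sum.inr (Sum.inr i))

/-- A vector conforming to one with vanishing blocks `y², …, yⁿ` has vanishing blocks too. -/
theorem Conforms.exists_extendVec_eq {t p q n : ℕ} (hn : 0 < n)
    {w : (Fin n × Fin t) ⊕ ((Fin n × Fin p) ⊕ (Fin n × Fin q)) → ℤ}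
    {v : (Fin n × Fin t) ⊕ (Fin p ⊕ Fin n × Fin q) → ℤ}
    (h : Conforms w (extendVec n hn v)) : ∃ u, extendVec n hn u = w := by
  refine ⟨Sum.elim (fun i => w (Sum.inl i)) (Sum.elim
    (fun i => w (Sum.inr (Sum.inl (⟨0, hn⟩, i)))) fun i => w (Sum.inr (Sum.inr i))), ?_⟩
  ext (i | ⟨k, i⟩ | i)
  · rfl
  · by_cases hk : k = ⟨0, hn⟩
    · simp [extendVec, hk]
    · have := (h (Sum.inr (Sum.inl (k, i)))).2
      simp only [extendVec, Sum.elim_inr, Sum.elim_inl, hk, if_false, abs_zero,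
        abs_nonpos_iff] at this ⊢
      exact this.symm
  · rfl

theorem Cmat_mulVec_extendVec {r s t p q n : ℕ} (hn : 0 < n)
    (A₁ : Matrix (Fin r) (Fin t) ℤ) (A₂ : Matrix (Fin s) (Fin t) ℤ)
    (W₁ : Matrix (Fin p) (Fin t) ℤ) (W₂ : Matrix (Fin q) (Fin t) ℤ)
    (v : (Fin n × Fin t) ⊕ (Fin p ⊕ Fin n × Fin q) → ℤ) :
    (Cmat n A₁ A₂ W₁ W₂).mulVec (extendVec n hn v) = (Bmat n A₁ A₂ W₁ W₂).mulVec v := by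
  ext (i | i | i)
  · simp [Matrix.mulVec, dotProduct, Fintype.sum_sum_type, Cmat, Bmat, extendVec]
  · simp [Matrix.mulVec, dotProduct, Fintype.sum_sum_type, Cmat, Bmat, extendVec, nFold,
      Matrix.one_apply, Fintype.sum_prod_type]
  · simp [Matrix.mulVec, dotProduct, Fintype.sum_sum_type, Cmat, Bmat, extendVec, nFold,
      Matrix.one_apply]

/-- The Graver basis of `B = [A⁽ⁿ⁾ 0; W⁽ⁿ⁾ I]` consists exactly of the restrictions
`(x, y¹, z)` of those elements `(x, y¹, …, yⁿ, z)` of the Graver basis of `C` whose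
blocks `y², …, yⁿ` all vanish. -/
theorem graverBasis_B_eq_restrictions (r s t p q n : ℕ) (hn : 0 < n)
    (A₁ : Matrix (Fin r) (Fin t) ℤ) (A₂ : Matrix (Fin s) (Fin t) ℤ)
    (W₁ : Matrix (Fin p) (Fin t) ℤ) (W₂ : Matrix (Fin q) (Fin t) ℤ) :
    GraverBasis (Bmat n A₁ A₂ W₁ W₂) =
      {v | extendVec n hn v ∈ GraverBasis (Cmat n A₁ A₂ W₁ W₂)} := by
  ext v
  simp only [GraverBasis, Set.mem_ofPred_eq, Cmat_mulVec_extendVec, extendVec_ne_zero_iff]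
  refine and_congr_right fun _ => and_congr_right fun _ => ⟨fun h w hw hw0 hc => ?_,
    fun h u hu hu0 hc => ?_⟩
  · obtain ⟨u, rfl⟩ := hc.exists_extendVec_eq hn
    rw [Cmat_mulVec_extendVec] at hw
    rw [h u hw ((extendVec_ne_zero_iff hn u).1 hw0) ((conforms_extendVec_iff hn u v).1 hc)]
  · refine extendVec_injective hn (h _ ?_ ((extendVec_ne_zero_iff hn u).2 hu0)
      ((conforms_extendVec_iff hn u v).2 hc))
    rw [Cmat_mulVec_extendVec, hu]
end

section
/- Let n, l be positive integers and write a = (u, d¹, …, d^l) with u ∈ ℤ^{3n} and d^k ∈ ℤ^{3+n}, and index x ∈ ℤ^{3nl} as x = (x¹, …, x^l) with x^k ∈ ℤ^{3n}. If d¹ = 𝟏₃^{[n]} u − Σ_{k=2}^l d^k, then the set of integer points {x ∈ ℤ^{3nl} : x ≥ 0, 𝟏₃^{[n][l]} x = a} equals the set of vectors (u − Σ_{k=2}^l x^k, x², …, x^l) where (x², …, x^l) ranges over all feasible (l−1)-commodity transshipments over K_{3,n} with demand vectors d², …, d^l and edge capacities u, i.e., over all (x²,…,x^l) with x^k ∈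 ℤ^{3n}, x^k ≥ 0, 𝟏₃^{[n]} x^k = d^k for k = 2,…,l, and Σ_{k=2}^l x^k ≤ u; if d¹ ≠ 𝟏₃^{[n]} u − Σ_{k=2}^l d^k, then this set of integer points is empty. -/
/-- For a matrix `D` with rows `α` and columns `β`, the matrix `D^{[n]}` is `A⁽ⁿ⁾` for
the bimatrix `A` with `A₁ = I` and `A₂ = D`. -/
def sqFold {α β : Type*} [DecidableEq β] (D : Matrix α β ℤ) (n : ℕ) :
    Matrix (β ⊕ Fin n × α) (Fin n × β) ℤ :=
  nFold n (1 : Matrix β β ℤ) D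

/-- The `1 × 3` all-ones matrix `𝟏₃ = [1 1 1]`; `𝟏₃^{[n]}` is the vertex-edge incidence
matrix of the complete bipartite graph `K_{3,n}`. -/
def one3 : Matrix (Fin 1) (Fin 3) ℤ := Matrix.of fun _ _ => 1

/-- The equations of `D^{[n]}`: the bricks of `x` sum to `u`, and `D` maps each brick to the
corresponding right-hand side. -/
theorem sqFold_mulVec_eq_elim_iff {α β : Type*} [Fintype β] [DecidableEq β]
    (D : Matrix α β ℤ) (n : ℕ) (x : Fin n × β → ℤ) (u : β → ℤ) (d : Fin n → α → ℤ) :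
    (sqFold D n).mulVec x = Sum.elim u (fun kw => d kw.1 kw.2) ↔
      (∀ e, ∑ k, x (k, e) = u e) ∧ ∀ k, D.mulVec (fun e => x (k, e)) = d k := by
  have h_sum (e : β) : (sqFold D n).mulVec x (Sum.inl e) = ∑ k, x (k, e) := by
    simp [sqFold, nFold, Matrix.mulVec, dotProduct, Fintype.sum_prod_type, Matrix.one_apply]
  have h_brick (k : Fin n) (w : α) :
      (sqFold D n).mulVec x (Sum.inr (k, w)) = D.mulVec (fun e => x (k, e)) w := by
    simp only [sqFold, nFold, Matrix.mulVec, dotProduct, Fintype.sum_prod_type, Matrix.of_apply,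
      ite_mul, zero_mul]
    rw [Finset.sum_eq_single k] <;> simp +contextual [eq_comm]
  simp [funext_iff, Sum.forall, Prod.forall, h_sum, h_brick]

/-- `D` commutes with summing the bricks of `x`. -/
theorem mulVec_sum_bricks {α β κ : Type*} [Fintype β] (D : Matrix α β ℤ) (s : Finset κ)
    (x : κ × β → ℤ) :
    D.mulVec (fun e => ∑ k ∈ s, x (k, e)) = ∑ k ∈ s, D.mulVec (fun e => x (k, e)) := by
  rw [← Matrix.mulVec_sum]
  congr 1
  ext e
  simp

/-- The integer points of the polytope `{x ≥ 0 : 𝟏₃^{[n][l]} x = a}` with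
`a = (u, d¹, …, dˡ)`: if `d¹ = 𝟏₃^{[n]} u - Σ_{k≥2} dᵏ`, they are exactly the vectors
`(u - Σ_{k≥2} xᵏ, x², …, xˡ)` where `(x², …, xˡ)` ranges over the feasible
`(l-1)`-commodity transshipments over `K_{3,n}` with demands `d², …, dˡ` and capacities
`u`; otherwise there are no integer points at all. -/
theorem universality_transshipment_fibers (n l : ℕ) (hn : 0 < n) (hl : 0 < l)
    (u : Fin n × Fin 3 → ℤ) (d : Fin l → (Fin 3 ⊕ Fin n × Fin 1) → ℤ) :
    let M := sqFold one3 n;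
    let Ml := sqFold M l;
    let k₀ : Fin l := ⟨0, hl⟩;
    let a : (Fin n × Fin 3) ⊕ Fin l × (Fin 3 ⊕ Fin n × Fin 1) → ℤ :=
      Sum.elim u (fun kw => d kw.1 kw.2);
    let S : Set (Fin l × (Fin n × Fin 3) → ℤ) :=
      {x | (∀ p, 0 ≤ x p) ∧ Ml.mulVec x = a};
    (d k₀ = M.mulVec u - ∑ k ∈ Finset.univ.erase k₀, d k →
      S = {x | (∀ k, k ≠ k₀ →
              (∀ e, 0 ≤ x (k, e)) ∧ M.mulVec (fun e => x (k, e)) = d k) ∧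
            (∀ e, ∑ k ∈ Finset.univ.erase k₀, x (k, e) ≤ u e) ∧
            (∀ e, x (k₀, e) = u e - ∑ k ∈ Finset.univ.erase k₀, x (k, e))}) ∧
    (d k₀ ≠ M.mulVec u - ∑ k ∈ Finset.univ.erase k₀, d k → S = ∅) := by
  intro M Ml k₀ a S
  have h_split {N : Type} [AddCommGroup N] (f : Fin l → N) :
      f k₀ + ∑ k ∈ Finset.univ.erase k₀, f k = ∑ k, f k :=
    Finset.add_sum_erase _ f (Finset.mem_univ k₀)
  have h_mem (x : Fin l × (Fin n × Fin 3) → ℤ) : x ∈ S ↔ (∀ p, 0 ≤ x p) ∧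
      (∀ e, ∑ k, x (k, e) = u e) ∧ ∀ k, M.mulVec (fun e => x (k, e)) = d k :=
    and_congr_right fun _ => sqFold_mulVec_eq_elim_iff M l x u d
  constructor
  · intro hd
    ext x
    rw [h_mem, Set.mem_ofPred_eq]
    constructor
    · rintro ⟨h_nonneg, h_sum, h_brick⟩
      refine ⟨fun k _ => ⟨fun e => h_nonneg _, h_brick k⟩, fun e => ?_, fun e => ?_⟩
      · have := h_split fun k => x (k, e)
        linarith [h_sum e, h_nonneg (k₀, e)]
      · have := h_split fun k => x (k, e)
        linarith [h_sum e]
    · rintro ⟨h_feas, h_cap, h_slack⟩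
      refine ⟨fun ⟨k, e⟩ => ?_, fun e => ?_, fun k => ?_⟩
      · by_cases hk : k = k₀
        · subst hk
          linarith [h_cap e, h_slack e]
        · exact (h_feas k hk).1 e
      · rw [← h_split, h_slack e, sub_add_cancel]
      · by_cases hk : k = k₀
        · have h_eq : (fun e => x (k₀, e)) =
              u - fun e => ∑ k ∈ Finset.univ.erase k₀, x (k, e) := funext h_slack
          rw [hk, h_eq, Matrix.mulVec_sub, mulVec_sum_bricks, hd]
          congr 1
          exact Finset.sum_congr rfl fun j hj => (h_feas j (Finset.ne_of_mem_erase hj)).2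
        · exact (h_feas k hk).2
  · intro hd
    refine Set.eq_empty_of_forall_notMem fun x hx => hd ?_
    obtain ⟨-, h_sum, h_brick⟩ := (h_mem x).1 hx
    rw [eq_sub_iff_add_eq, h_split, ← funext h_sum, mulVec_sum_bricks]
    exact Finset.sum_congr rfl fun k _ => (h_brick k).symm
end

section
/- For every digraph G with s vertices and t edges and incidence matrix D, there exists a nonnegative integer g(G) (the Graver complexity of G) such that for every positive integer l, every element (x¹, …, x^l) of the Graver basis 𝒢(D^{[l]}) has at most g(G) nonzero blocks x^k ∈ ℤ^t. -/
/-- The vertex-edge incidence matrix of a digraph given by head and tail maps: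
entry `1` if the edge enters the vertex, `-1` if it leaves it, `0` otherwise. -/
def incidence {s t : ℕ} (head tail : Fin t → Fin s) : Matrix (Fin s) (Fin t) ℤ :=
  Matrix.of fun v e => (if head e = v then 1 else 0) + (if tail e = v then -1 else 0)


theorem Conforms.refl {β : Type*} (x : β → ℤ) : Conforms x x :=
  fun _ => ⟨mul_self_nonneg _, le_rfl⟩

theorem Conforms.trans {β : Type*} {x y z : β → ℤ} (hxy : Conforms x y) (hyz : Conforms y z) :
    Conforms x z := by
  intro i
  refine ⟨?_, (hxy i).2.trans (hyz i).2⟩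
  by_cases hy : y i = 0
  · have hx : x i = 0 := by simpa [hy] using (hxy i).2
    simp [hx]
  · have h : 0 ≤ (x i * z i) * (y i * y i) := by
      have := mul_nonneg (hxy i).1 (hyz i).1
      linarith
    exact nonneg_of_mul_nonneg_left h (mul_self_pos.mpr hy)

theorem conforms_of_toNat_le {β : Type*} {x y : β → ℤ}
    (hpos : ∀ i, (x i).toNat ≤ (y i).toNat) (hneg : ∀ i, (-x i).toNat ≤ (-y i).toNat) :
    Conforms x y := by
  intro i
  have h₁ := hpos i
  have h₂ := hneg i
  rcases le_total 0 (x i) with hx | hx <;> rcases le_total 0 (y i) with hy | hy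
  · exact ⟨mul_nonneg hx hy, by rw [abs_of_nonneg hx, abs_of_nonneg hy]; omega⟩
  · have hx' : x i = 0 := by omega
    simp [hx']
  · have hx' : x i = 0 := by omega
    simp [hx']
  · exact ⟨mul_nonneg_of_nonpos_of_nonpos hx hy,
      by rw [abs_of_nonpos hx, abs_of_nonpos hy]; omega⟩

/-- The Gordan–Dickson lemma: `⊑` is a well-quasi-order on integer vectors. -/
theorem partiallyWellOrderedOn_conforms (β : Type*) [Finite β] :
    (Set.univ : Set (β → ℤ)).PartiallyWellOrderedOn Conforms := by
  rw [Set.partiallyWellOrderedOn_iff_exists_lt]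
  intro f _
  obtain ⟨m, n, hmn, h⟩ := Set.partiallyWellOrderedOn_iff_exists_lt.mp
    (Set.isPWO_of_wellQuasiOrderedLE (Set.univ : Set (β ⊕ β → ℕ)))
    (fun n => Sum.elim (fun i => (f n i).toNat) (fun i => (-f n i).toNat)) (fun _ => trivial)
  exact ⟨m, n, hmn, conforms_of_toNat_le (fun i => h (Sum.inl i)) (fun i => h (Sum.inr i))⟩

theorem List.SublistForall₂.exists_orderEmbedding_ofFn {A : Type*} {R : A → A → Prop} {m n : ℕ}
    {f : Fin m → A} {g : Fin n → A}
    (h : List.SublistForall₂ R (List.ofFn f) (List.ofFn g)) :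
    ∃ e : Fin m ↪o Fin n, ∀ i, R (f i) (g (e i)) := by
  obtain ⟨L, hL, hsub⟩ := List.sublistForall₂_iff.mp h
  obtain ⟨e, he⟩ := List.sublist_iff_exists_fin_orderEmbedding_get_eq.mp hsub
  obtain ⟨hlen, hR⟩ := List.forall₂_iff_get.mp hL
  have hm : m = L.length := by simpa using hlen
  refine ⟨(Fin.castOrderIso hm).toOrderEmbedding.trans
    (e.trans (Fin.castOrderIso (List.length_ofFn (f := g))).toOrderEmbedding), fun i => ?_⟩
  have h₁ := hR i (by simp) (hm ▸ i.2)
  have h₂ := he ⟨i, hm ▸ i.2⟩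
  rw [h₂] at h₁
  rw [List.get_ofFn, List.get_ofFn] at h₁
  exact h₁

theorem sqFold_mulVec_eq_zero_iff {α β : Type*} [DecidableEq β] [Fintype β] (D : Matrix α β ℤ)
    (n : ℕ) (x : Fin n × β → ℤ) :
    (sqFold D n).mulVec x = 0 ↔
      (∑ k, fun e => x (k, e)) = 0 ∧ ∀ k, D.mulVec (fun e => x (k, e)) = 0 := by
  have hsum (b : β) : (sqFold D n).mulVec x (Sum.inl b) = ∑ k, x (k, b) := by
    simp [sqFold, nFold, Matrix.mulVec, dotProduct, Fintype.sum_prod_type, Matrix.one_apply]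
  have hblock (k : Fin n) (a : α) :
      (sqFold D n).mulVec x (Sum.inr (k, a)) = D.mulVec (fun e => x (k, e)) a := by
    simp only [sqFold, nFold, Matrix.mulVec, dotProduct, Fintype.sum_prod_type, Matrix.of_apply]
    rw [Finset.sum_eq_single k] <;> simp +contextual [eq_comm]
  constructor
  · intro h
    refine ⟨funext fun b => ?_, fun k => funext fun a => ?_⟩
    · simpa [hsum] using congrFun h (Sum.inl b)
    · simpa [hblock] using congrFun h (Sum.inr (k, a))
  · rintro ⟨h₁, h₂⟩
    funext i
    rcases i with b | ⟨k, a⟩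
    · simpa [hsum] using congrFun h₁ b
    · simpa [hblock] using congrFun (h₂ k) a

/-- Padding a vector of the kernel of `D^{[m]}` with zero blocks keeps it in the kernel, so a
blockwise `⊑`-embedding of one Graver basis element into another preserves the type. -/
theorem ncard_blocks_eq_of_embedding {α β : Type*} [DecidableEq β] [Fintype β]
    {D : Matrix α β ℤ} {m n : ℕ} {x : Fin m × β → ℤ} {z : Fin n × β → ℤ}
    (hx : x ∈ GraverBasis (sqFold D m)) (hz : z ∈ GraverBasis (sqFold D n))
    (e : Fin m ↪ Fin n)
    (he : ∀ i, Conforms (fun b => x (i, b)) (fun b => z (e i, b))) :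
    {k | (fun b => x (k, b)) ≠ 0}.ncard = {k | (fun b => z (k, b)) ≠ 0}.ncard := by
  let blocks : Fin m → β → ℤ := fun k b => x (k, b)
  let pad : Fin n → β → ℤ := Function.extend e blocks 0
  have pad_apply (k : Fin m) : pad (e k) = blocks k := e.injective.extend_apply _ _ k
  have pad_zero (k : Fin n) (hk : k ∉ Set.range e) : pad k = 0 :=
    Function.extend_apply' _ _ _ hk
  obtain ⟨hxker, hx0, -⟩ := hx
  rw [sqFold_mulVec_eq_zero_iff] at hxker
  have hpad : (fun p => pad p.1 p.2) = z := by
    refine hz.2.2 _ ?_ ?_ ?_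
    · rw [sqFold_mulVec_eq_zero_iff]
      refine ⟨?_, fun k => ?_⟩
      · rw [← hxker.1]
        exact (Fintype.sum_of_injective e e.injective blocks pad pad_zero
          fun k => (pad_apply k).symm).symm
      · by_cases hk : k ∈ Set.range e
        · obtain ⟨i, rfl⟩ := hk
          change D.mulVec (pad (e i)) = 0
          rw [pad_apply]
          exact hxker.2 i
        · change D.mulVec (pad k) = 0
          rw [pad_zero k hk, Matrix.mulVec_zero]
    · intro h
      apply hx0
      funext ⟨k, b⟩
      have := congrFun h (e k, b)
      simpa [pad_apply, blocks] using this
    · rintro ⟨k, b⟩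
      by_cases hk : k ∈ Set.range e
      · obtain ⟨i, rfl⟩ := hk
        simpa only [pad_apply] using he i b
      · simp [pad_zero k hk]
  have himage : {k | (fun b => z (k, b)) ≠ 0} = e '' {k | (fun b => x (k, b)) ≠ 0} := by
    ext k
    rw [← hpad]
    change pad k ≠ 0 ↔ _
    by_cases hk : k ∈ Set.range e
    · obtain ⟨i, rfl⟩ := hk
      rw [pad_apply, e.injective.mem_set_image]
      rfl
    · simp only [pad_zero k hk, ne_eq, not_true_eq_false, false_iff]
      exact fun h => hk (Set.image_subset_range _ _ h)
  rw [himage, Set.ncard_image_of_injective _ e.injective]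

/-- Existence of the Graver complexity of an arbitrary integer matrix, by Higman's lemma. -/
theorem exists_bound_ncard_blocks {α β : Type*} [DecidableEq β] [Fintype β]
    (D : Matrix α β ℤ) :
    ∃ g : ℕ, ∀ l : ℕ, ∀ x ∈ GraverBasis (sqFold D l),
      {k : Fin l | (fun e => x (k, e)) ≠ 0}.ncard ≤ g := by
  by_contra! hcon
  choose l x hx hlt using hcon
  obtain ⟨φ, -, hφ⟩ := Filter.strictMono_subseq_of_id_le (fun g => (hlt g).le)
  have : IsPreorder (β → ℤ) Conforms :=
    { refl := Conforms.refl, trans := fun _ _ _ => Conforms.trans }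
  obtain ⟨i, j, hij, hsub⟩ := Set.partiallyWellOrderedOn_iff_exists_lt.mp
    (Set.PartiallyWellOrderedOn.partiallyWellOrderedOn_sublistForall₂ Conforms
      (partiallyWellOrderedOn_conforms β))
    (fun g => List.ofFn fun k e => x (φ g) (k, e)) (fun _ _ _ => trivial)
  obtain ⟨e, he⟩ := hsub.exists_orderEmbedding_ofFn
  exact (hφ hij).ne (ncard_blocks_eq_of_embedding (hx _) (hx _) e.toEmbedding he)

/-- Existence of the Graver complexity `g(G)` of a digraph `G`: there is a nonnegative
integer `g` such that, for every positive `l`, every element `(x¹, …, xˡ)` of the Graver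
basis `𝒢(D^{[l]})` of the `l`-fold matrix of the incidence matrix `D` of `G` has at most
`g` nonzero blocks `xᵏ ∈ ℤ^t`. -/
theorem graver_complexity_exists (s t : ℕ) (head tail : Fin t → Fin s) :
    let D := incidence head tail;
    ∃ g : ℕ, ∀ l : ℕ, 0 < l → ∀ x ∈ GraverBasis (sqFold D l),
      ({k : Fin l | (fun e => x (k, e)) ≠ 0}).ncard ≤ g := by
  obtain ⟨g, hg⟩ := exists_bound_ncard_blocks (incidence head tail)
  exact ⟨g, fun l _ x hx => hg l x hx⟩
end

section
/- For every integer m×n matrix A and every nonzero x ∈ ℤ^n with Ax = 0, there exist elements g₁, …, g_k of the Graver basis 𝒢(A) and positive integers λ₁, …, λ_k such that x = Σ_{i=1}^k λ_i g_i and g_i ⊑ x for all i; that is, every nonzero integer vector in the kernel of A is a nonnegative integer conformal combination of Graver basis elements. -/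
theorem Conforms.sub_left {β : Type*} {x y : β → ℤ} (h : Conforms y x) : Conforms (x - y) x := by
  intro i
  obtain ⟨hs, ha⟩ := h i
  rw [Pi.sub_apply]
  rcases le_total 0 (x i) with hx | hx
  · rw [abs_of_nonneg hx] at ha ⊢
    have := abs_le.mp ha
    have hy : 0 ≤ y i := by
      by_contra! hy
      nlinarith
    exact ⟨mul_nonneg (by omega) hx, abs_le.mpr (by omega)⟩
  · rw [abs_of_nonpos hx] at ha ⊢
    have := abs_le.mp ha
    have hy : y i ≤ 0 := by
      by_contra! hy
      nlinarith
    exact ⟨mul_nonneg_of_nonpos_of_nonpos (by omega) hx, abs_le.mpr (by omega)⟩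

theorem Conforms.eq_of_abs_eq {β : Type*} {x y : β → ℤ} (h : Conforms y x)
    (habs : ∀ i, |y i| = |x i|) : y = x := by
  funext i
  rcases abs_eq_abs.mp (habs i) with hi | hi
  · exact hi
  · have := (h i).1
    rw [hi] at this ⊢
    have : x i = 0 := by nlinarith [mul_self_nonneg (x i)]
    simp [this]

theorem Conforms.sum_natAbs_lt {β : Type*} [Fintype β] {x y : β → ℤ} (h : Conforms y x)
    (hne : y ≠ x) : ∑ i, (y i).natAbs < ∑ i, (x i).natAbs := by
  have hle (i : β) : (y i).natAbs ≤ (x i).natAbs := Int.natAbs_le_iff_sq_le.mpr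
    (sq_le_sq.mpr (h i).2)
  refine (Finset.sum_le_sum fun i _ => hle i).lt_of_ne fun heq => hne (h.eq_of_abs_eq fun i => ?_)
  have := (Finset.sum_eq_sum_iff_of_le fun i _ => hle i).mp heq i (Finset.mem_univ i)
  rw [Int.abs_eq_natAbs, Int.abs_eq_natAbs, this]

/-- Kernel vectors lie in the additive monoid generated by the conforming Graver basis elements. -/
theorem mem_closure_graverBasis {α β : Type*} [Fintype β] (A : Matrix α β ℤ) (x : β → ℤ)
    (hker : A.mulVec x = 0) :
    x ∈ AddSubmonoid.closure {g | g ∈ GraverBasis A ∧ Conforms g x} := by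
  induction hN : ∑ i, (x i).natAbs using Nat.strong_induction_on generalizing x with
  | _ N ih =>
    subst hN
    rcases eq_or_ne x 0 with rfl | hx
    · exact zero_mem _
    by_cases hG : x ∈ GraverBasis A
    · exact AddSubmonoid.subset_closure ⟨hG, fun i => ⟨mul_self_nonneg _, le_rfl⟩⟩
    obtain ⟨y, hy, hy0, hyx, hne⟩ : ∃ y : β → ℤ,
        A.mulVec y = 0 ∧ y ≠ 0 ∧ Conforms y x ∧ y ≠ x := by
      by_contra! hmin
      exact hG ⟨hker, hx, hmin⟩
    have mem_of_conforms (z : β → ℤ) (hz : A.mulVec z = 0) (hzx : Conforms z x) (hzne : z ≠ x) :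
        z ∈ AddSubmonoid.closure {g | g ∈ GraverBasis A ∧ Conforms g x} := by
      refine AddSubmonoid.closure_mono ?_ (ih _ (hzx.sum_natAbs_lt hzne) z hz rfl)
      exact fun g hg => ⟨hg.1, hg.2.trans hzx⟩
    have hsub := mem_of_conforms (x - y) (by rw [Matrix.mulVec_sub, hker, hy, sub_zero])
      hyx.sub_left (by simpa using hy0)
    simpa using add_mem (mem_of_conforms y hy hyx hne) hsub

/-- Every nonzero integer vector in the kernel of `A` is a nonnegative integer conformal
combination of Graver basis elements: `x = Σ_i λ_i g_i` with `λ_i` positive integers,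
`g_i ∈ 𝒢(A)` and `g_i ⊑ x` for all `i`. -/
theorem conformal_graver_decomposition (m n : ℕ) (A : Matrix (Fin m) (Fin n) ℤ)
    (x : Fin n → ℤ) (hker : A.mulVec x = 0) (hx : x ≠ 0) :
    ∃ (k : ℕ) (g : Fin k → Fin n → ℤ) (lam : Fin k → ℕ),
      (∀ i, g i ∈ GraverBasis A) ∧ (∀ i, 0 < lam i) ∧
      x = ∑ i, (lam i : ℤ) • g i ∧ ∀ i, Conforms (g i) x := by
  obtain ⟨l, hl, hsum⟩ := AddSubmonoid.exists_list_of_mem_closure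
    (mem_closure_graverBasis A x hker)
  refine ⟨l.length, l.get, fun _ => 1, fun i => (hl _ (l.get_mem i)).1, fun _ => one_pos, ?_,
    fun i => (hl _ (l.get_mem i)).2⟩
  simp only [Nat.cast_one, one_smul]
  rw [← List.sum_ofFn, List.ofFn_get, hsum]
end

section
/- Let D be the 6×9 incidence matrix of the complete bipartite digraph K_{3,3} with all 9 edges oriented from one side to the other. Then the Graver complexity g(K_{3,3}) equals 9; that is, the maximum, over all positive integers l and all elements (x¹,…,x^l) of 𝒢(D^{[l]}), of the number of nonzero blocks x^k ∈ ℤ^9, equals 9. -/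
/-- The `6 × 9` vertex-edge incidence matrix of the complete bipartite digraph `K₃,₃`,
with all `9` edges `(i,j)` oriented from the left vertex `i` to the right vertex `j`:
entry `1` if the edge enters the vertex, `-1` if it leaves it, `0` otherwise. -/
def incK33 : Matrix (Fin 3 ⊕ Fin 3) (Fin 3 × Fin 3) ℤ :=
  Matrix.of fun v e =>
    match v with
    | Sum.inl i => if e.1 = i then -1 else 0
    | Sum.inr j => if e.2 = j then 1 else 0

/-- The divergence (out-degree minus in-degree) at each vertex of a multiset of arcs. -/
def arcDiv {V : Type*} [DecidableEq V] (M : Multiset (V × V)) (v : V) : ℤ :=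
  (M.map fun a => (if a.1 = v then 1 else 0) - (if a.2 = v then 1 else 0)).sum

section Graph

variable {V : Type*} [DecidableEq V]

@[simp] lemma arcDiv_zero (v : V) : arcDiv 0 v = 0 := rfl

@[simp] lemma arcDiv_cons (a : V × V) (M : Multiset (V × V)) (v : V) :
    arcDiv (a ::ₘ M) v =
      (if a.1 = v then 1 else 0) - (if a.2 = v then 1 else 0) + arcDiv M v := by
  simp [arcDiv]

lemma arcDiv_map_swap (M : Multiset (V × V)) (v : V) :
    arcDiv (M.map Prod.swap) v = -arcDiv M v := by
  induction M using Multiset.induction_on with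
  | empty => simp
  | cons a M ih => simp [ih]; ring

lemma sum_map_sub_eq_sum_arcDiv [Fintype V] (M : Multiset (V × V)) (h : V → ℤ) :
    (M.map fun a => h a.1 - h a.2).sum = ∑ v, arcDiv M v * h v := by
  induction M using Multiset.induction_on with
  | empty => simp
  | cons a M ih => simp [ih, add_mul, sub_mul, Finset.sum_add_distrib]

/-- A finite multiset of arcs either contains a union of disjoint directed cycles or is acyclic. -/
lemma exists_cycle_or_wellFounded [Fintype V] (M : Multiset (V × V)) :
    (∃ N ≤ M, N ≠ 0 ∧ N.card ≤ Fintype.card V ∧ ∀ v, arcDiv N v = 0) ∨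
      WellFounded fun a b => (a, b) ∈ M := by
  classical
  by_cases hwf : WellFounded fun a b => (a, b) ∈ M
  · exact Or.inr hwf
  left
  rw [WellFounded.wellFounded_iff_has_min] at hwf
  push Not at hwf
  obtain ⟨s, ⟨m, hm⟩, hs⟩ := hwf
  choose! f hfs hfM using hs
  have hfM' : ∀ v ∈ s, (f v, v) ∈ M := hfM
  let F : s → s := fun v => ⟨f v, hfs v v.2⟩
  let P : Finset s := Finset.univ.filter (· ∈ Function.periodicPts F)
  have hP : P.Nonempty := by
    obtain ⟨i, j, hij, h⟩ := Finite.exists_ne_map_eq_of_infinite fun n : ℕ => F^[n] ⟨m, hm⟩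
    wlog hlt : i < j generalizing i j
    · exact this j i hij.symm h.symm (by omega)
    refine ⟨F^[i] ⟨m, hm⟩, ?_⟩
    simp only [P, Finset.mem_filter, Finset.mem_univ, true_and]
    refine Function.mk_mem_periodicPts (n := j - i) (by omega) ?_
    rw [Function.IsPeriodicPt, Function.IsFixedPt, ← Function.iterate_add_apply]
    rw [show j - i + i = j by omega]
    exact h.symm
  let g : s → V × V := fun v => (f v, v)
  have hg : Function.Injective g := fun a b h => Subtype.ext (congrArg Prod.snd h)
  refine ⟨(P.image g).val, ?_, ?_, ?_, ?_⟩
  · rw [Multiset.le_iff_subset (P.image g).nodup]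
    intro a ha
    obtain ⟨v, -, rfl⟩ := Finset.mem_image.1 ha
    exact hfM' v v.2
  · simpa only [ne_eq, Finset.val_eq_zero, Finset.image_eq_empty] using hP.ne_empty
  · rw [Finset.card_val, Finset.card_image_of_injective _ hg]
    exact (Finset.card_le_univ P).trans (Fintype.card_subtype_le _)
  · intro v
    have hsum : arcDiv (P.image g).val v =
        ∑ a ∈ P.image g, ((if a.1 = v then 1 else 0) - (if a.2 = v then 1 else 0)) := rfl
    rw [hsum, Finset.sum_image hg.injOn, Finset.sum_sub_distrib, sub_eq_zero]
    have hb := Function.bijOn_periodicPts F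
    refine Finset.sum_nbij F ?_ ?_ ?_ fun _ _ => rfl
    · intro a ha
      simpa [P] using hb.mapsTo (by simpa [P] using ha)
    · simpa [P] using hb.injOn
    · simpa [P] using hb.surjOn

end Graph

/-- Arcs of an acyclic multiset increase along some enumeration of the vertices. -/
lemma exists_equiv_fin_lt {V : Type*} [Fintype V] {M : Multiset (V × V)}
    (hM : WellFounded fun a b => (a, b) ∈ M) :
    ∃ e : V ≃ Fin (Fintype.card V), ∀ a ∈ M, e a.1 < e a.2 := by
  classical
  have := IsWellFounded.mk hM
  obtain ⟨s, hle, hs⟩ := IsWellFounded.exists_well_order_ge fun a b => (a, b) ∈ M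
  let _ : LinearOrder V := linearOrderOfSTO s
  let e := (Fintype.orderIsoFinOfCardEq V rfl).symm
  exact ⟨e.toEquiv, fun a ha => e.lt_iff_lt.2 (hle _ _ ha)⟩


/-- Left vertices have weight `1` and right vertices weight `-1`. -/
def sideWeight : Fin 3 ⊕ Fin 3 → ℤ := Sum.elim 1 (-1)

lemma exists_perm_pos (m : Fin 3 → Fin 3 → ℤ) (hm : ∀ i j, 0 ≤ m i j) {k : ℤ} (hk : 0 < k)
    (hr : ∀ i, ∑ j, m i j = k) (hc : ∀ j, ∑ i, m i j = k) :
    ∃ σ : Equiv.Perm (Fin 3), ∀ i, 0 < m i (σ i) := by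
  by_contra! h
  have key (σ : Equiv.Perm (Fin 3)) : m 0 (σ 0) = 0 ∨ m 1 (σ 1) = 0 ∨ m 2 (σ 2) = 0 := by
    obtain ⟨i, hi⟩ := h σ
    have := hm i (σ i)
    fin_cases i <;> simp at hi this <;> omega
  have h1 := key 1
  have h2 := key (Equiv.swap 0 1)
  have h3 := key (Equiv.swap 0 2)
  have h4 := key (Equiv.swap 1 2)
  have h5 := key (finRotate 3)
  have h6 := key (finRotate 3)⁻¹
  simp only [show (1 : Equiv.Perm (Fin 3)) 0 = 0 by decide,
    show (1 : Equiv.Perm (Fin 3)) 1 = 1 by decide, show (1 : Equiv.Perm (Fin 3)) 2 = 2 by decide,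
    show (Equiv.swap 0 1 : Equiv.Perm (Fin 3)) 0 = 1 by decide,
    show (Equiv.swap 0 1 : Equiv.Perm (Fin 3)) 1 = 0 by decide,
    show (Equiv.swap 0 1 : Equiv.Perm (Fin 3)) 2 = 2 by decide,
    show (Equiv.swap 0 2 : Equiv.Perm (Fin 3)) 0 = 2 by decide,
    show (Equiv.swap 0 2 : Equiv.Perm (Fin 3)) 1 = 1 by decide,
    show (Equiv.swap 0 2 : Equiv.Perm (Fin 3)) 2 = 0 by decide,
    show (Equiv.swap 1 2 : Equiv.Perm (Fin 3)) 0 = 0 by decide,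
    show (Equiv.swap 1 2 : Equiv.Perm (Fin 3)) 1 = 2 by decide,
    show (Equiv.swap 1 2 : Equiv.Perm (Fin 3)) 2 = 1 by decide,
    show finRotate 3 0 = 1 by decide, show finRotate 3 1 = 2 by decide,
    show finRotate 3 2 = 0 by decide, show (finRotate 3)⁻¹ 0 = 2 by decide,
    show (finRotate 3)⁻¹ 1 = 0 by decide, show (finRotate 3)⁻¹ 2 = 1 by decide]
    at h1 h2 h3 h4 h5 h6
  simp only [Fin.forall_fin_succ, Fin.sum_univ_three, Fin.isValue, Fin.succ_zero_eq_one,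
    Fin.succ_one_eq_two, IsEmpty.forall_iff, and_true] at hm hr hc
  rcases h1 with h | h | h <;> rcases h2 with h' | h' | h' <;> omega

lemma arcDiv_map_inl (M : Multiset (Fin 3 × Fin 3)) (i : Fin 3) :
    arcDiv (M.map (Prod.map Sum.inl Sum.inr)) (Sum.inl i : Fin 3 ⊕ Fin 3) =
      ∑ j, (M.count (i, j) : ℤ) := by
  induction M using Multiset.induction_on with
  | empty => simp
  | cons a M ih =>
    obtain ⟨a, b⟩ := a
    simp [ih, Multiset.count_cons, Finset.sum_add_distrib, add_comm, ite_and, eq_comm]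

lemma arcDiv_map_inr (M : Multiset (Fin 3 × Fin 3)) (j : Fin 3) :
    arcDiv (M.map (Prod.map Sum.inl Sum.inr)) (Sum.inr j : Fin 3 ⊕ Fin 3) =
      -∑ i, (M.count (i, j) : ℤ) := by
  induction M using Multiset.induction_on with
  | empty => simp
  | cons a M ih =>
    obtain ⟨a, b⟩ := a
    simp [ih, Multiset.count_cons, Finset.sum_add_distrib, add_comm, ite_and, eq_comm]

lemma arcDiv_nonneg_of_forall_snd_ne {V : Type*} [DecidableEq V] {M : Multiset (V × V)} {v : V}
    (h : ∀ a ∈ M, a.2 ≠ v) : 0 ≤ arcDiv M v := by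
  refine Multiset.sum_nonneg fun x hx => ?_
  obtain ⟨a, ha, rfl⟩ := Multiset.mem_map.1 hx
  simp only [h a ha, if_false]
  split_ifs <;> simp

lemma arcDiv_pos {V : Type*} [DecidableEq V] {M : Multiset (V × V)} {a : V × V}
    (ha : a ∈ M) (h : ∀ b ∈ M, b.2 ≠ a.1) : 0 < arcDiv M a.1 := by
  rw [← Multiset.cons_erase ha, arcDiv_cons]
  have := arcDiv_nonneg_of_forall_snd_ne (M := M.erase a) (v := a.1)
    fun b hb => h b (Multiset.mem_of_mem_erase hb)
  simp only [h a ha, if_false, if_true]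
  omega

/-- Integrality: a flow of value `k > 0` from all left to all right vertices contains one of
value `1`. -/
lemma exists_le_arcDiv_eq_sideWeight {k : ℤ} (hk : 0 < k)
    (M : Multiset ((Fin 3 ⊕ Fin 3) × (Fin 3 ⊕ Fin 3)))
    (hM : ∀ v, arcDiv M v = k * sideWeight v) :
    ∃ N ≤ M, ∀ v, arcDiv N v = sideWeight v := by
  induction hn : M.card using Nat.strong_induction_on generalizing M with
  | _ n ih =>
  by_cases hloop : ∃ a, (a, a) ∈ M
  · obtain ⟨a, ha⟩ := hloop
    obtain ⟨L, rfl⟩ := Multiset.exists_cons_of_mem ha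
    obtain ⟨N, hN, hNd⟩ := ih L.card (by simp [← hn]) L (by simpa using hM) rfl
    exact ⟨N, hN.trans (Multiset.le_cons_self _ _), hNd⟩
  by_cases hpath : ∃ a v b, (a, v) ∈ M ∧ (v, b) ∈ M
  · obtain ⟨a, v, b, hav, hvb⟩ := hpath
    obtain ⟨L, rfl⟩ := Multiset.exists_cons_of_mem hav
    have hvb' : (v, b) ∈ L := by
      rcases Multiset.mem_cons.1 hvb with h | h
      · obtain ⟨rfl, rfl⟩ := Prod.mk.inj h
        exact absurd ⟨_, hav⟩ hloop
      · exact h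
    obtain ⟨L, rfl⟩ := Multiset.exists_cons_of_mem hvb'
    obtain ⟨N, hN, hNd⟩ := ih ((a, b) ::ₘ L).card (by simp [← hn]) ((a, b) ::ₘ L)
      (fun u => by rw [← hM u]; simp only [arcDiv_cons]; ring) rfl
    by_cases hab : (a, b) ∈ N
    · obtain ⟨N, rfl⟩ := Multiset.exists_cons_of_mem hab
      refine ⟨(a, v) ::ₘ (v, b) ::ₘ N, by simpa using hN, fun u => ?_⟩
      rw [← hNd u]; simp only [arcDiv_cons]; ring
    · refine ⟨N, ((Multiset.le_cons_of_notMem hab).1 hN).trans ?_, hNd⟩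
      exact (Multiset.le_cons_self _ _).trans (Multiset.le_cons_self _ _)
  have hfst : ∀ a ∈ M, ∃ i, a.1 = Sum.inl i := by
    intro a ha
    have := arcDiv_pos ha fun b hb h => hpath ⟨b.1, b.2, a.2, hb, by rw [h]; exact ha⟩
    rw [hM] at this
    rcases h : a.1 with i | i
    · exact ⟨i, rfl⟩
    · simp [h, sideWeight] at this; omega
  have hsnd : ∀ a ∈ M, ∃ i, a.2 = Sum.inr i := by
    intro a ha
    have := arcDiv_pos (M := M.map Prod.swap) (a := a.swap) (Multiset.mem_map_of_mem _ ha) (by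
      intro b hb h
      obtain ⟨c, hc, rfl⟩ := Multiset.mem_map.1 hb
      exact hpath ⟨a.1, a.2, c.2, ha, by simp at h; rw [← h]; exact hc⟩)
    rw [arcDiv_map_swap, hM] at this
    rcases h : a.2 with i | i
    · simp [h, sideWeight] at this; omega
    · exact ⟨i, rfl⟩
  obtain ⟨L, rfl⟩ : ∃ L : Multiset (Fin 3 × Fin 3), L.map (Prod.map Sum.inl Sum.inr) = M := by
    refine ⟨M.map fun a => (a.1.elim id id, a.2.elim id id), ?_⟩
    rw [Multiset.map_map]
    conv_rhs => rw [← Multiset.map_id M]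
    refine Multiset.map_congr rfl fun a ha => ?_
    obtain ⟨i, hi⟩ := hfst a ha
    obtain ⟨j, hj⟩ := hsnd a ha
    ext <;> simp [hi, hj]
  obtain ⟨σ, hσ⟩ := exists_perm_pos (fun i j => L.count (i, j)) (by simp) hk
    (fun i => by rw [← arcDiv_map_inl, hM]; simp [sideWeight])
    (fun j => by
      rw [← neg_inj, ← arcDiv_map_inr, hM]; simp [sideWeight])
  refine ⟨(Finset.univ.val.map fun i => (i, σ i)).map (Prod.map Sum.inl Sum.inr),
    Multiset.map_le_map ?_, ?_⟩
  · rw [Multiset.le_iff_subset]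
    · intro a ha
      obtain ⟨i, -, rfl⟩ := Multiset.mem_map.1 ha
      simpa [Multiset.count_pos] using hσ i
    · exact Finset.univ.nodup.map fun i j h => congrArg Prod.fst h
  · clear hσ
    revert σ
    decide

lemma card_le_of_arcDiv_eq_sideWeight {M : Multiset ((Fin 3 ⊕ Fin 3) × (Fin 3 ⊕ Fin 3))}
    {k : ℤ} (hk : |k| ≤ 1) (hM : ∀ v, arcDiv M v = k * sideWeight v)
    (hwf : WellFounded fun a b => (a, b) ∈ M) : M.card ≤ 9 := by
  obtain ⟨e, he⟩ := exists_equiv_fin_lt hwf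
  have h1 : (M.card : ℤ) ≤ (M.map fun a => -((e a.1 : ℕ) : ℤ) - -((e a.2 : ℕ) : ℤ)).sum := by
    have := Multiset.card_nsmul_le_sum (s := M.map fun a => -((e a.1 : ℕ) : ℤ) - -((e a.2 : ℕ) : ℤ))
      (a := 1) (by
        intro x hx
        obtain ⟨a, ha, rfl⟩ := Multiset.mem_map.1 hx
        have := he a ha
        rw [Fin.lt_def] at this
        omega)
    simpa using this
  rw [sum_map_sub_eq_sum_arcDiv M fun v => -((e v : ℕ) : ℤ)] at h1
  simp only [hM, Fintype.sum_sum_type, sideWeight, Fin.sum_univ_three, Sum.elim_inl, Sum.elim_inr,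
    Pi.one_apply, Pi.neg_apply] at h1
  have hsum : ∑ v, ((e v : ℕ) : ℤ) = 15 := by
    rw [Equiv.sum_comp e fun i => ((i : ℕ) : ℤ)]
    rfl
  rw [Fintype.sum_sum_type, Fin.sum_univ_three, Fin.sum_univ_three] at hsum
  have hne (u v : Fin 3 ⊕ Fin 3) (h : u ≠ v) : (e u : ℕ) ≠ e v :=
    fun h' => h (e.injective (Fin.ext h'))
  have a1 := hne (Sum.inl 0) (Sum.inl 1) (by decide)
  have a2 := hne (Sum.inl 0) (Sum.inl 2) (by decide)
  have a3 := hne (Sum.inl 1) (Sum.inl 2) (by decide)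
  have b1 := hne (Sum.inr 0) (Sum.inr 1) (by decide)
  have b2 := hne (Sum.inr 0) (Sum.inr 2) (by decide)
  have b3 := hne (Sum.inr 1) (Sum.inr 2) (by decide)
  obtain ⟨hk1, hk2⟩ := abs_le.1 hk
  obtain rfl | rfl | rfl : k = -1 ∨ k = 0 ∨ k = 1 := by omega
  all_goals omega

/-- A multiset of arcs on `Fin 3 ⊕ Fin 3` which is minimal among those whose divergence is a
multiple of `sideWeight` has at most `9` elements. -/
lemma card_le_nine {M : Multiset ((Fin 3 ⊕ Fin 3) × (Fin 3 ⊕ Fin 3))}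
    (hM : ∃ k : ℤ, ∀ v, arcDiv M v = k * sideWeight v)
    (hmin : ∀ N ≤ M, N ≠ 0 → (∃ k : ℤ, ∀ v, arcDiv N v = k * sideWeight v) → N = M) :
    M.card ≤ 9 := by
  rcases exists_cycle_or_wellFounded M with ⟨N, hN, hN0, hcard, hd⟩ | hwf
  · rw [← hmin N hN hN0 ⟨0, by simpa using hd⟩]
    exact hcard.trans (by decide)
  have key : ∀ c : ℤ, |c| = 1 → ∀ N ≤ M, (∀ v, arcDiv N v = c * sideWeight v) → M.card ≤ 9 := by
    intro c hc N hN hd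
    have hN0 : N ≠ 0 := by
      rintro rfl
      have := hd (Sum.inl 0)
      simp [sideWeight] at this
      simp [← this] at hc
    obtain rfl := hmin N hN hN0 ⟨c, hd⟩
    exact card_le_of_arcDiv_eq_sideWeight hc.le hd hwf
  obtain ⟨k, hk⟩ := hM
  rcases lt_trichotomy k 0 with h | rfl | h
  · obtain ⟨N, hN, hd⟩ := exists_le_arcDiv_eq_sideWeight (k := -k) (by omega) (M.map Prod.swap)
      (fun v => by rw [arcDiv_map_swap, hk]; ring)
    refine key (-1) (by simp) (N.map Prod.swap) ?_ fun v => by rw [arcDiv_map_swap, hd]; ring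
    simpa [Multiset.map_map] using Multiset.map_le_map (f := Prod.swap) hN
  · exact card_le_of_arcDiv_eq_sideWeight (by simp) hk hwf
  · obtain ⟨N, hN, hd⟩ := exists_le_arcDiv_eq_sideWeight h M hk
    exact key 1 (by simp) N hN (by simpa using hd)

/-- The six `3 × 3` permutation matrices: the even ones on the left, the odd ones on the right. -/
def permVec (v : Fin 3 ⊕ Fin 3) (e : Fin 3 × Fin 3) : ℤ :=
  v.elim (fun i => if e.2 - e.1 = i then 1 else 0) fun j => if e.1 + e.2 = j then 1 else 0

/-- The difference of the permutation matrices at the two ends of an arc; for distinct ends, these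
are the signed incidence vectors of the cycles of `K₃,₃`. -/
def arcVec (a : (Fin 3 ⊕ Fin 3) × (Fin 3 ⊕ Fin 3)) (e : Fin 3 × Fin 3) : ℤ :=
  permVec a.1 e - permVec a.2 e

lemma sum_arcVec_eq_zero_iff (M : Multiset ((Fin 3 ⊕ Fin 3) × (Fin 3 ⊕ Fin 3))) :
    (∀ e, (M.map fun a => arcVec a e).sum = 0) ↔
      ∃ k : ℤ, ∀ v, arcDiv M v = k * sideWeight v := by
  have h (e) : (M.map fun a => arcVec a e).sum = ∑ v, arcDiv M v * permVec v e :=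
    sum_map_sub_eq_sum_arcDiv M (permVec · e)
  simp only [h]
  constructor
  · intro h
    refine ⟨arcDiv M (Sum.inl 0), ?_⟩
    have h' := fun i j => h (i, j)
    simp [Fin.forall_fin_succ, permVec, sideWeight,
      show (1 : Fin 3) + 1 = 2 by decide, show (1 : Fin 3) + 2 = 0 by decide,
      show (2 : Fin 3) + 1 = 0 by decide, show (2 : Fin 3) + 2 = 1 by decide,
      show (2 : Fin 3) - 1 = 1 by decide, show (1 : Fin 3) - 2 = 2 by decide] at h' ⊢
    omega
  · rintro ⟨k, hk⟩ e
    have : ∀ e, ∑ v, sideWeight v * permVec v e = 0 := by decide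
    simp only [hk, mul_assoc, ← Finset.mul_sum, this, mul_zero]

/-- All line sums of `z` vanish. -/
def IsCirculation (z : Fin 3 × Fin 3 → ℤ) : Prop :=
  (∀ i, ∑ j, z (i, j) = 0) ∧ ∀ j, ∑ i, z (i, j) = 0

lemma isCirculation_arcVec (a) : IsCirculation (arcVec a) := by
  obtain ⟨a, b⟩ := a
  unfold IsCirculation
  revert a b
  decide

lemma exists_neg_of_sum_eq_zero {ι : Type*} [Fintype ι] {f : ι → ℤ} (h : ∑ i, f i = 0) {i : ι}
    (hi : 0 < f i) : ∃ j, f j < 0 := by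
  by_contra! hf
  exact hi.ne' ((Finset.sum_eq_zero_iff_of_nonneg fun j _ => hf j).1 h i (Finset.mem_univ i))

lemma exists_pos_of_sum_eq_zero {ι : Type*} [Fintype ι] {f : ι → ℤ} (h : ∑ i, f i = 0) {i : ι}
    (hi : f i < 0) : ∃ j, 0 < f j := by
  by_contra! hf
  exact hi.ne ((Finset.sum_eq_zero_iff_of_nonpos fun j _ => hf j).1 h i (Finset.mem_univ i))

lemma exists_perm_of_ne : ∀ i i' m : Fin 3, i ≠ i' → i ≠ m → i' ≠ m →
    ∀ j j' k : Fin 3, j ≠ j' → j ≠ k → j' ≠ k →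
    ∃ σ : Equiv.Perm (Fin 3), σ i = j ∧ σ i' = j' ∧ σ m = k := by
  decide +kernel

lemma exists_third : ∀ i i' : Fin 3, ∃ m, i ≠ m ∧ i' ≠ m := by
  decide

lemma exists_permVec_eq : ∀ σ : Equiv.Perm (Fin 3), ∃ v, ∀ e,
    permVec v e = if σ e.1 = e.2 then 1 else 0 := by
  decide +kernel

lemma exists_perm_conforms {z : Fin 3 × Fin 3 → ℤ} (hz : IsCirculation z) (h0 : z ≠ 0) :
    ∃ σ τ : Equiv.Perm (Fin 3), σ ≠ τ ∧
      ∀ i, σ i ≠ τ i → 0 < z (i, σ i) ∧ z (i, τ i) < 0 := by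
  obtain ⟨hr, hc⟩ := hz
  have four : ∀ i i' j j', 0 < z (i, j) → z (i, j') < 0 → 0 < z (i', j') → z (i', j) < 0 →
      ∃ σ τ : Equiv.Perm (Fin 3), σ ≠ τ ∧
        ∀ i, σ i ≠ τ i → 0 < z (i, σ i) ∧ z (i, τ i) < 0 := by
    intro i i' j j' h1 h2 h3 h4
    have hi : i ≠ i' := by rintro rfl; omega
    have hj : j ≠ j' := by rintro rfl; omega
    obtain ⟨m, him, him'⟩ := exists_third i i'
    obtain ⟨k, hjk, hjk'⟩ := exists_third j j'
    obtain ⟨σ, s1, s2, s3⟩ := exists_perm_of_ne i i' m hi him him' j j' k hj hjk hjk'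
    obtain ⟨τ, t1, t2, t3⟩ := exists_perm_of_ne i i' m hi him him' j' j k hj.symm hjk' hjk
    refine ⟨σ, τ, ?_, fun l hl => ?_⟩
    · rintro rfl
      exact hj (s1.symm.trans t1)
    · obtain rfl | rfl | rfl : l = i ∨ l = i' ∨ l = m := by omega
      · rw [s1, t1]; exact ⟨h1, h2⟩
      · rw [s2, t2]; exact ⟨h3, h4⟩
      · exact absurd (s3.trans t3.symm) hl
  obtain ⟨i, j, hij⟩ : ∃ i j, 0 < z (i, j) := by
    obtain ⟨⟨i, j⟩, h⟩ := Function.ne_iff.1 h0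
    rcases lt_or_gt_of_ne h with h | h
    · exact ⟨i, exists_pos_of_sum_eq_zero (hr i) h⟩
    · exact ⟨i, j, h⟩
  obtain ⟨j', hij'⟩ := exists_neg_of_sum_eq_zero (hr i) hij
  obtain ⟨i', hi'j'⟩ := exists_pos_of_sum_eq_zero (hc j') hij'
  obtain ⟨k, hi'k⟩ := exists_neg_of_sum_eq_zero (hr i') hi'j'
  by_cases hkj : k = j
  · subst hkj
    exact four _ _ _ _ hij hij' hi'j' hi'k
  obtain ⟨m, hmk⟩ := exists_pos_of_sum_eq_zero (hc k) hi'k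
  by_cases hmi : m = i
  · subst hmi
    exact four _ _ _ _ hmk hij' hi'j' hi'k
  have hi : i ≠ i' := by rintro rfl; omega
  have hj : j ≠ j' := by rintro rfl; omega
  have hm : i' ≠ m := by rintro rfl; omega
  have hk : j' ≠ k := by rintro rfl; omega
  obtain ⟨l, hml⟩ := exists_neg_of_sum_eq_zero (hr m) hmk
  have hlk : l ≠ k := by rintro rfl; omega
  obtain rfl | rfl : l = j ∨ l = j' := by omega
  · obtain ⟨σ, s1, s2, s3⟩ := exists_perm_of_ne i i' m hi (Ne.symm hmi) hm l j' k hj hlk hk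
    obtain ⟨τ, t1, t2, t3⟩ :=
      exists_perm_of_ne i i' m hi (Ne.symm hmi) hm j' k l hk hj.symm hlk.symm
    refine ⟨σ, τ, ?_, fun n hn => ?_⟩
    · rintro rfl
      exact hj (s1.symm.trans t1)
    · obtain rfl | rfl | rfl : n = i ∨ n = i' ∨ n = m := by omega
      · rw [s1, t1]; exact ⟨hij, hij'⟩
      · rw [s2, t2]; exact ⟨hi'j', hi'k⟩
      · rw [s3, t3]; exact ⟨hmk, hml⟩
  · exact four _ _ _ _ hmk hml hi'j' hi'k

/-- Every nonzero circulation can be reduced by a signed cycle in its own orthant. -/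
lemma exists_arcVec_conforms {z : Fin 3 × Fin 3 → ℤ} (hz : IsCirculation z) (h0 : z ≠ 0) :
    ∃ a : (Fin 3 ⊕ Fin 3) × (Fin 3 ⊕ Fin 3), a.1 ≠ a.2 ∧
      ∀ e, |z e| = |arcVec a e| + |z e - arcVec a e| := by
  obtain ⟨σ, τ, hne, h⟩ := exists_perm_conforms hz h0
  obtain ⟨u, hu⟩ := exists_permVec_eq σ
  obtain ⟨v, hv⟩ := exists_permVec_eq τ
  refine ⟨(u, v), ?_, fun e => ?_⟩
  · intro huv
    obtain rfl : u = v := huv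
    refine hne (Equiv.ext fun i => ?_)
    have := hu (i, σ i)
    rw [hv] at this
    simpa [eq_comm] using this
  · obtain ⟨i, j⟩ := e
    simp only [arcVec, hu, hv]
    by_cases hστ : σ i = τ i
    · simp [hστ]
    · obtain ⟨h1, h2⟩ := h i hστ
      split_ifs with h3 h4 h4
      · simp
      · subst h3
        rw [abs_of_pos h1, sub_zero, abs_one, abs_of_nonneg (by omega)]
        ring
      · subst h4
        rw [abs_of_neg h2, zero_sub, abs_neg, abs_one, abs_of_nonpos (by omega)]
        ring
      · simp

lemma exists_arcVec_ne_zero (a : (Fin 3 ⊕ Fin 3) × (Fin 3 ⊕ Fin 3)) (ha : a.1 ≠ a.2) :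
    ∃ e, arcVec a e ≠ 0 := by
  obtain ⟨a, b⟩ := a
  revert a b
  decide

/-- Conformal decomposition of a circulation into signed cycles. -/
lemma exists_conformal_decomposition {z : Fin 3 × Fin 3 → ℤ} (hz : IsCirculation z) :
    ∃ L : Multiset ((Fin 3 ⊕ Fin 3) × (Fin 3 ⊕ Fin 3)), (∀ a ∈ L, a.1 ≠ a.2) ∧
      (∀ e, z e = (L.map fun a => arcVec a e).sum) ∧
      ∀ e, |z e| = (L.map fun a => |arcVec a e|).sum := by
  induction hn : ∑ e, (z e).natAbs using Nat.strong_induction_on generalizing z with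
  | _ n ih =>
  by_cases h0 : z = 0
  · exact ⟨0, by simp, by simp [h0], by simp [h0]⟩
  obtain ⟨a, ha, hc⟩ := exists_arcVec_conforms hz h0
  have hlt : ∑ e, (z e - arcVec a e).natAbs < n := by
    rw [← hn]
    obtain ⟨e, he⟩ := exists_arcVec_ne_zero a ha
    refine Finset.sum_lt_sum (fun e _ => ?_) ⟨e, Finset.mem_univ e, ?_⟩
    · have := hc e
      rw [Int.abs_eq_natAbs, Int.abs_eq_natAbs, Int.abs_eq_natAbs] at this
      omega
    · have := hc e
      rw [Int.abs_eq_natAbs, Int.abs_eq_natAbs, Int.abs_eq_natAbs] at this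
      omega
  have hz' : IsCirculation fun e => z e - arcVec a e := by
    obtain ⟨h1, h2⟩ := isCirculation_arcVec a
    exact ⟨fun i => by rw [Finset.sum_sub_distrib, hz.1, h1, sub_zero],
      fun j => by rw [Finset.sum_sub_distrib, hz.2, h2, sub_zero]⟩
  obtain ⟨L, hL1, hL2, hL3⟩ := ih _ hlt hz' rfl
  refine ⟨a ::ₘ L, ?_, fun e => ?_, fun e => ?_⟩
  · simpa [ha] using hL1
  · rw [Multiset.map_cons, Multiset.sum_cons, ← hL2]; ring
  · rw [Multiset.map_cons, Multiset.sum_cons, ← hL3, hc e]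

lemma Multiset.exists_le_sum_eq_of_le {ι α : Type*} [DecidableEq α] (s : Finset ι)
    (L : ι → Multiset α) (N : Multiset α) (h : N ≤ ∑ k ∈ s, L k) :
    ∃ N' : ι → Multiset α, (∀ k, N' k ≤ L k) ∧ ∑ k ∈ s, N' k = N := by
  classical
  induction s using Finset.induction_on generalizing N with
  | empty => exact ⟨0, fun _ => Multiset.zero_le _, by simpa [eq_comm] using h⟩
  | insert k s hk ih =>
    rw [Finset.sum_insert hk] at h
    obtain ⟨N', h1, h2⟩ := ih (N - L k) (by rwa [tsub_le_iff_left])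
    refine ⟨Function.update N' k (N ∩ L k), fun j => ?_, ?_⟩
    · by_cases hj : j = k
      · subst hj; simp [Multiset.inter_le_right]
      · simpa [hj] using h1 j
    · rw [Finset.sum_insert hk, Function.update_self, Finset.sum_congr rfl fun j hj =>
        Function.update_of_ne (ne_of_mem_of_not_mem hj hk) _ _, h2, add_comm]
      exact Multiset.sub_add_inter N (L k)

lemma abs_sum_map_le {α : Type*} (L : Multiset α) (f : α → ℤ) :
    |(L.map f).sum| ≤ (L.map fun a => |f a|).sum := by
  induction L using Multiset.induction_on with
  | empty => simp
  | cons a L ih =>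
    simp only [Multiset.map_cons, Multiset.sum_cons]
    exact (abs_add_le _ _).trans (by gcongr)

lemma abs_sum_map_of_le {α : Type*} {N L : Multiset α} (hN : N ≤ L) (f : α → ℤ)
    (hL : |(L.map f).sum| = (L.map fun a => |f a|).sum) :
    0 ≤ (N.map f).sum * (L.map f).sum ∧ |(N.map f).sum| ≤ |(L.map f).sum| ∧
      |(N.map f).sum| = (N.map fun a => |f a|).sum := by
  obtain ⟨K, rfl⟩ := Multiset.le_iff_exists_add.1 hN
  simp only [Multiset.map_add, Multiset.sum_add] at hL ⊢
  have h1 := abs_sum_map_le N f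
  have h2 := abs_sum_map_le K f
  have h3 := abs_add_le (N.map f).sum (K.map f).sum
  generalize (N.map f).sum = x at *
  generalize (K.map f).sum = y at *
  refine ⟨?_, by have := abs_nonneg y; omega, by omega⟩
  have : 0 ≤ x * y := by
    rcases (abs_add_eq_add_abs_iff x y).1 (by omega) with h | h
    · exact mul_nonneg h.1 h.2
    · exact mul_nonneg_of_nonpos_of_nonpos h.1 h.2
  nlinarith [sq_nonneg x]

lemma eq_zero_of_sum_abs_arcVec {L : Multiset ((Fin 3 ⊕ Fin 3) × (Fin 3 ⊕ Fin 3))}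
    (hL : ∀ a ∈ L, a.1 ≠ a.2) (h : ∀ e, (L.map fun a => |arcVec a e|).sum = 0) : L = 0 := by
  by_contra h0
  obtain ⟨a, ha⟩ := Multiset.exists_mem_of_ne_zero h0
  obtain ⟨e, he⟩ := exists_arcVec_ne_zero a (hL a ha)
  have := Multiset.single_le_sum (s := L.map fun a => |arcVec a e|)
    (fun x hx => by obtain ⟨b, -, rfl⟩ := Multiset.mem_map.1 hx; exact abs_nonneg _)
    _ (Multiset.mem_map_of_mem _ ha)
  rw [h e] at this
  exact he (abs_nonpos_iff.1 this)

lemma isCirculation_sum_arcVec (L : Multiset ((Fin 3 ⊕ Fin 3) × (Fin 3 ⊕ Fin 3))) :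
    IsCirculation fun e => (L.map fun a => arcVec a e).sum := by
  induction L using Multiset.induction_on with
  | empty => simp [IsCirculation]
  | cons a L ih =>
    obtain ⟨h1, h2⟩ := isCirculation_arcVec a
    simp only [IsCirculation, Multiset.map_cons, Multiset.sum_cons, Finset.sum_add_distrib] at ih ⊢
    exact ⟨fun i => by rw [h1, ih.1, add_zero], fun j => by rw [h2, ih.2, add_zero]⟩

lemma sqFold_incK33_mulVec_eq_zero_iff {l : ℕ} (x : Fin l × (Fin 3 × Fin 3) → ℤ) :
    (sqFold incK33 l).mulVec x = 0 ↔
      (∀ e, ∑ k, x (k, e) = 0) ∧ ∀ k, IsCirculation fun e => x (k, e) := by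
  rw [funext_iff, Sum.forall]
  have hl (e) : (sqFold incK33 l).mulVec x (Sum.inl e) = ∑ k, x (k, e) := by
    rw [Matrix.mulVec, dotProduct, Fintype.sum_prod_type]
    simp [sqFold, nFold, Matrix.one_apply]
  have hr (k v) : (sqFold incK33 l).mulVec x (Sum.inr (k, v)) = ∑ e, incK33 v e * x (k, e) := by
    rw [Matrix.mulVec, dotProduct, Fintype.sum_prod_type]
    simp only [sqFold, nFold, Matrix.of_apply, ite_mul, zero_mul]
    rw [Finset.sum_eq_single k (fun j _ hj => by simp [hj.symm]) (by simp)]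
    simp
  refine and_congr (forall_congr' fun e => by rw [hl]; rfl) ?_
  rw [Prod.forall]
  refine forall_congr' fun k => ?_
  rw [Sum.forall, IsCirculation]
  refine and_congr (forall_congr' fun i => ?_) (forall_congr' fun j => ?_)
  · rw [hr, Fintype.sum_prod_type, Finset.sum_eq_single i]
    · simp [incK33]
    · intro b _ hb
      simp [incK33, hb]
    · simp
  · rw [hr, Fintype.sum_prod_type_right, Finset.sum_eq_single j]
    · simp [incK33]
    · intro b _ hb
      simp [incK33, hb]
    · simp

lemma ncard_blocks_le_nine {l : ℕ} {x : Fin l × (Fin 3 × Fin 3) → ℤ}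
    (hx : x ∈ GraverBasis (sqFold incK33 l)) :
    ({k : Fin l | (fun e => x (k, e)) ≠ 0}).ncard ≤ 9 := by
  obtain ⟨hx0, -, hmin⟩ := hx
  rw [sqFold_incK33_mulVec_eq_zero_iff] at hx0
  obtain ⟨hsum, hcirc⟩ := hx0
  choose L hL1 hL2 hL3 using fun k => exists_conformal_decomposition (hcirc k)
  have hsumL (N : Fin l → Multiset ((Fin 3 ⊕ Fin 3) × (Fin 3 ⊕ Fin 3))) (e : Fin 3 × Fin 3) :
      ((∑ k, N k).map fun a => arcVec a e).sum = ∑ k, ((N k).map fun a => arcVec a e).sum := by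
    rw [← Multiset.coe_mapAddMonoidHom, map_sum, Multiset.sum_sum]
  have hcard : (∑ k, L k).card ≤ 9 := by
    refine card_le_nine ((sum_arcVec_eq_zero_iff _).1 fun e => ?_) fun N hN hN0 hNd => ?_
    · rw [hsumL, ← hsum e]
      exact Finset.sum_congr rfl fun k _ => (hL2 k e).symm
    · obtain ⟨N, hNL, rfl⟩ := Multiset.exists_le_sum_eq_of_le _ _ _ hN
      have hN0' := (sum_arcVec_eq_zero_iff _).2 hNd
      have habs (k e) := abs_sum_map_of_le (hNL k) (fun a => arcVec a e)
        (by rw [← hL2, ← hL3])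
      have hyx := hmin (fun p => ((N p.1).map fun a => arcVec a p.2).sum) ?_ ?_ ?_
      · refine Finset.sum_congr rfl fun k _ => ?_
        obtain ⟨K, hK⟩ := Multiset.le_iff_exists_add.1 (hNL k)
        have hK0 : K = 0 := by
          refine eq_zero_of_sum_abs_arcVec (fun a ha => hL1 k a (by simp [hK, ha])) fun e => ?_
          have h1 := (habs k e).2.2
          have h2 := hL3 k e
          have h3 := congrFun hyx (k, e)
          simp only [hK, Multiset.map_add, Multiset.sum_add] at h1 h2 h3
          rw [← h1, h3] at h2
          omega
        rw [hK, hK0, add_zero]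
      · rw [sqFold_incK33_mulVec_eq_zero_iff]
        exact ⟨fun e => by rw [← hN0' e, hsumL], fun k => isCirculation_sum_arcVec (N k)⟩
      · intro h0
        refine hN0 (Finset.sum_eq_zero fun k _ => ?_)
        refine eq_zero_of_sum_abs_arcVec (fun a ha => hL1 k a (Multiset.mem_of_le (hNL k) ha))
          fun e => ?_
        rw [← (habs k e).2.2]
        exact abs_eq_zero.2 (congrFun h0 (k, e))
      · rintro ⟨k, e⟩
        rw [hL2 k e]
        exact ⟨(habs k e).1, (habs k e).2.1⟩
  refine le_trans ?_ hcard
  rw [Set.ncard_eq_toFinset_card', Multiset.card_sum, Finset.card_eq_sum_ones]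
  refine (Finset.sum_le_sum (g := fun k => (L k).card) fun k hk => ?_).trans
    (Finset.sum_le_univ_sum_of_nonneg fun k => Nat.zero_le _)
  rw [Nat.one_le_iff_ne_zero, ne_eq, Multiset.card_eq_zero]
  intro h
  simp only [ne_eq, Set.mem_toFinset, Set.mem_ofPred_eq] at hk
  exact hk (funext fun e => by simp [hL2, h])

/-- Nine arcs forming the path `E₀ → E₁ → E₂ → O₀ → O₁ → O₂` with multiplicities `1,2,3,2,1`. -/
def pathArcs : Fin 9 → (Fin 3 ⊕ Fin 3) × (Fin 3 ⊕ Fin 3) :=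
  ![(.inl 0, .inl 1), (.inl 1, .inl 2), (.inl 1, .inl 2), (.inl 2, .inr 0), (.inl 2, .inr 0),
    (.inl 2, .inr 0), (.inr 0, .inr 1), (.inr 0, .inr 1), (.inr 1, .inr 2)]

lemma eq_of_arcVec_conforms : ∀ c d a b : Fin 3 ⊕ Fin 3, c ≠ d →
    (∀ e, 0 ≤ arcVec (c, d) e * arcVec (a, b) e ∧
      (arcVec (c, d) e).natAbs ≤ (arcVec (a, b) e).natAbs) → (c, d) = (a, b) := by
  decide +kernel

lemma eq_zero_or_eq_arcVec_of_conforms {a : (Fin 3 ⊕ Fin 3) × (Fin 3 ⊕ Fin 3)}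
    {y : Fin 3 × Fin 3 → ℤ} (hy : IsCirculation y) (h : Conforms y (arcVec a)) :
    ∃ t : ℤ, (t = 0 ∨ t = 1) ∧ ∀ e, y e = t * arcVec a e := by
  by_cases h0 : y = 0
  · exact ⟨0, by simp [h0]⟩
  obtain ⟨c, hc, hcy⟩ := exists_arcVec_conforms hy h0
  have hle (e) : 0 ≤ arcVec c e * arcVec a e ∧ |arcVec c e| ≤ |arcVec a e| := by
    obtain ⟨h1, h2⟩ := h e
    have h3 := hcy e
    refine ⟨?_, by have := abs_nonneg (y e - arcVec c e); omega⟩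
    rcases lt_trichotomy (y e) 0 with hneg | hz | hpos
    · exact mul_nonneg_of_nonpos_of_nonpos (by grind) (by nlinarith)
    · have : arcVec c e = 0 := by grind
      simp [this]
    · exact mul_nonneg (by grind) (by nlinarith)
  obtain rfl : c = a := eq_of_arcVec_conforms c.1 c.2 a.1 a.2 hc fun e =>
    ⟨(hle e).1, by have := (hle e).2; rwa [Int.abs_eq_natAbs, Int.abs_eq_natAbs, Nat.cast_le] at this⟩
  refine ⟨1, Or.inr rfl, fun e => ?_⟩
  have h1 := (h e).2
  have h2 := hcy e
  rw [one_mul, ← sub_eq_zero, ← abs_nonpos_iff]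
  omega

lemma pathArcs_mem_graverBasis :
    (fun p : Fin 9 × (Fin 3 × Fin 3) => arcVec (pathArcs p.1) p.2) ∈
      GraverBasis (sqFold incK33 9) := by
  refine ⟨?_, ?_, fun y hy hy0 hyx => ?_⟩
  · rw [sqFold_incK33_mulVec_eq_zero_iff]
    exact ⟨by decide, fun k => isCirculation_arcVec (pathArcs k)⟩
  · exact fun h => absurd (congrFun h (0, (0, 0))) (by decide)
  · rw [sqFold_incK33_mulVec_eq_zero_iff] at hy
    choose t ht01 ht using fun k =>
      eq_zero_or_eq_arcVec_of_conforms (a := pathArcs k) (hy.2 k) fun e => hyx (k, e)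
    have hsum (e) : ∑ k, t k * arcVec (pathArcs k) e = 0 := by
      rw [← hy.1 e]
      exact Finset.sum_congr rfl fun k _ => (ht k e).symm
    have hall : (∀ k, t k = 0) ∨ ∀ k, t k = 1 := by
      have e1 := hsum (0, 0)
      have e2 := hsum (1, 1)
      have e3 := hsum (2, 1)
      have e4 := hsum (2, 2)
      simp [Fin.sum_univ_succ, pathArcs, arcVec, permVec] at e1 e2 e3 e4
      have h0 := ht01 0
      have h1 := ht01 1
      have h2 := ht01 2
      have h3 := ht01 3
      have h4 := ht01 4
      have h5 := ht01 5
      have h6 := ht01 6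
      have h7 := ht01 7
      clear ht01 hsum ht
      rcases h0 with h0 | h0
      · left
        intro k
        fin_cases k <;> simp only [Fin.reduceFinMk, Fin.zero_eta, Fin.mk_one] <;> omega
      · right
        intro k
        fin_cases k <;> simp only [Fin.reduceFinMk, Fin.zero_eta, Fin.mk_one] <;> omega
    rcases hall with h | h
    · exact absurd (funext fun p => by rw [ht p.1 p.2, h, zero_mul]; rfl) hy0
    · exact funext fun p => by rw [ht p.1 p.2, h, one_mul]

/-- The Graver complexity of `K₃,₃` equals `9`: the maximum, over all positive integers
`l` and all elements `(x¹, …, xˡ)` of the Graver basis `𝒢(D^{[l]})` of the incidence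
matrix `D` of `K₃,₃`, of the number of nonzero blocks `xᵏ ∈ ℤ⁹`, equals `9`. -/
theorem graver_complexity_K33 :
    IsGreatest
      {c : ℕ | ∃ l : ℕ, 0 < l ∧ ∃ x ∈ GraverBasis (sqFold incK33 l),
        c = ({k : Fin l | (fun e => x (k, e)) ≠ 0}).ncard} 9 := by
  refine ⟨⟨9, by norm_num, _, pathArcs_mem_graverBasis, ?_⟩, ?_⟩
  · have : {k : Fin 9 | (fun e => arcVec (pathArcs k) e) ≠ 0} = Set.univ := by
      refine Set.eq_univ_of_forall fun k h => ?_
      have : ∀ k, (pathArcs k).1 ≠ (pathArcs k).2 := by decide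
      obtain ⟨e, he⟩ := exists_arcVec_ne_zero _ (this k)
      exact he (congrFun h e)
    rw [this, Set.ncard_univ, Nat.card_fin]
  · rintro c ⟨l, -, x, hx, rfl⟩
    exact ncard_blocks_le_nine hx
end
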